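/- arXiv:2008.02730 — 3 statements merged into one kernel-verified Lean document; each statement's English description precedes it below -/
import Mathlib

section
/- Let ρ be a density matrix on H_j ⊗ H_k with dim H_j = d_j, dim H_k = d_k, 2 ≤ d_j ≤ d_k. Define the correlation tensor entries t_{i_j i_k} = Tr(ρ (λ_{i_j} ⊗ λ_{i_k})), where λ's are SU(d_j) and SU(d_k) generators respectively. Then ∑_{i_j, i_k} t_{i_j i_k}² ≤ 4(d_j² − 1)/d_j². -/
open Matrix BigOperators ComplexOrder Kronecker

/-- A family of `d ^ 2 - 1` traceless Hermitian matrices with `Tr (λᵢ λⱼ) = 2 δᵢⱼ` becomes, together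
with the identity, an orthogonal basis of the `d × d` matrices; this is Parseval's identity for it. -/
lemma sum_norm_sq_trace_generator_mul {d : ℕ} (hd : 0 < d)
    (lam : Fin (d ^ 2 - 1) → Matrix (Fin d) (Fin d) ℂ)
    (hherm : ∀ i, (lam i).IsHermitian) (htr : ∀ i, (lam i).trace = 0)
    (horth : ∀ i j, (lam i * lam j).trace = if i = j then 2 else 0)
    (X : Matrix (Fin d) (Fin d) ℂ) :
    ∑ i, ‖(lam i * X).trace‖ ^ 2 = 2 * ∑ a, ∑ b, ‖X a b‖ ^ 2 - 2 / d * ‖X.trace‖ ^ 2 := by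
  have hdR : (0 : ℝ) < d := by exact_mod_cast hd
  let vec : Matrix (Fin d) (Fin d) ℂ → EuclideanSpace ℂ (Fin d × Fin d) :=
    fun M => WithLp.toLp 2 fun p => M p.1 p.2
  have inner_vec : ∀ M N, inner ℂ (vec M) (vec N) = (Mᴴ * N).trace := by
    intro M N
    simp only [vec, PiLp.inner_apply, RCLike.inner_apply, Fintype.sum_prod_type, Matrix.trace,
      Matrix.diag, Matrix.mul_apply, Matrix.conjTranspose_apply]
    rw [Finset.sum_comm]
    simp only [mul_comm, RCLike.star_def]
  let v : Option (Fin (d ^ 2 - 1)) → EuclideanSpace ℂ (Fin d × Fin d) := fun o =>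
    o.elim (((√d)⁻¹ : ℂ) • vec 1) fun i => ((√2)⁻¹ : ℂ) • vec (lam i)
  have hsd : ((√d : ℝ) : ℂ) * (√d : ℝ) = d := by
    rw [← Complex.ofReal_mul, Real.mul_self_sqrt hdR.le]; simp
  have hs2 : ((√2 : ℝ) : ℂ) * (√2 : ℝ) = 2 := by
    rw [← Complex.ofReal_mul, Real.mul_self_sqrt (by norm_num)]; simp
  have hv : Orthonormal ℂ v := by
    rw [orthonormal_iff_ite]
    rintro (_ | i) (_ | j)
    · simp only [v, Option.elim, inner_smul_left, inner_smul_right, inner_vec, map_inv₀,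
        Complex.conj_ofReal, Matrix.conjTranspose_one, mul_one, Matrix.trace_one, Fintype.card_fin,
        if_true]
      rw [← mul_assoc, ← mul_inv, hsd]
      exact inv_mul_cancel₀ (by exact_mod_cast hd.ne')
    · simp [v, inner_smul_left, inner_smul_right, inner_vec, htr]
    · simp [v, inner_smul_left, inner_smul_right, inner_vec, (hherm i).eq, htr]
    · simp only [v, Option.elim, inner_smul_left, inner_smul_right, inner_vec, map_inv₀,
        Complex.conj_ofReal, (hherm i).eq, horth, Option.some_inj]
      rw [← mul_assoc, ← mul_inv, hs2]
      split_ifs <;> simp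
  have hcard : Fintype.card (Option (Fin (d ^ 2 - 1))) =
      Module.finrank ℂ (EuclideanSpace ℂ (Fin d × Fin d)) := by
    have : 0 < d ^ 2 := by positivity
    simp only [Fintype.card_option, Fintype.card_fin, finrank_euclideanSpace, Fintype.card_prod]
    rw [← sq]
    omega
  have hspan : ⊤ ≤ Submodule.span ℂ (Set.range v) :=
    (hv.linearIndependent.span_eq_top_of_card_eq_finrank' hcard).ge
  have parseval := (OrthonormalBasis.mk hv hspan).sum_sq_norm_inner_right (vec X)
  have norm_vec : ‖vec X‖ ^ 2 = ∑ a, ∑ b, ‖X a b‖ ^ 2 := by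
    rw [EuclideanSpace.norm_sq_eq, Fintype.sum_prod_type]
  have norm_none : ‖inner ℂ (v none) (vec X)‖ ^ 2 = 1 / d * ‖X.trace‖ ^ 2 := by
    simp only [v, Option.elim, inner_smul_left, inner_vec, norm_mul, mul_pow,
      Matrix.conjTranspose_one, one_mul, map_inv₀, Complex.conj_ofReal, norm_inv,
      Complex.norm_real, Real.norm_eq_abs, inv_pow, sq_abs, Real.sq_sqrt hdR.le, one_div]
  have norm_some : ∀ i, ‖inner ℂ (v (some i)) (vec X)‖ ^ 2 = 1 / 2 * ‖(lam i * X).trace‖ ^ 2 := by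
    intro i
    simp only [v, Option.elim, inner_smul_left, inner_vec, norm_mul, mul_pow,
      (hherm i).eq, map_inv₀, Complex.conj_ofReal, norm_inv, Complex.norm_real, Real.norm_eq_abs,
      inv_pow, sq_abs, Real.sq_sqrt zero_le_two, one_div]
  simp only [OrthonormalBasis.coe_mk, Fintype.sum_option, norm_none, norm_some, norm_vec,
    ← Finset.mul_sum] at parseval
  rw [← parseval]
  ring

/-- The two reduced density matrices of a bipartite pure state have equal purity. -/
lemma sum_norm_sq_reduced_eq {m n : Type*} [Fintype m] [Fintype n] (C : Matrix m n ℂ) :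
    ∑ k, ∑ l, ‖∑ a, star (C a k) * C a l‖ ^ 2 = ∑ a, ∑ b, ‖∑ k, star (C a k) * C b k‖ ^ 2 := by
  apply Complex.ofReal_injective
  push_cast
  simp only [← Complex.conj_mul', map_sum, map_mul, RCLike.star_def, Complex.conj_conj,
    Finset.sum_mul_sum]
  let F : n → n → m → m → ℂ := fun k l a b =>
    C a k * starRingEnd ℂ (C a l) * (starRingEnd ℂ (C b k) * C b l)
  calc _ = ∑ k, ∑ l, ∑ a, ∑ b, F k l a b := rfl
    _ = ∑ k, ∑ a, ∑ b, ∑ l, F k l a b := Finset.sum_congr rfl fun k _ => by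
        rw [Finset.sum_comm]
        exact Finset.sum_congr rfl fun a _ => Finset.sum_comm
    _ = ∑ a, ∑ b, ∑ k, ∑ l, F k l a b := by
        rw [Finset.sum_comm]
        exact Finset.sum_congr rfl fun a _ => Finset.sum_comm
    _ = _ := by
        refine Finset.sum_congr rfl fun a _ => Finset.sum_congr rfl fun b _ =>
          Finset.sum_congr rfl fun k _ => Finset.sum_congr rfl fun l _ => ?_
        ring

/-- Cauchy–Schwarz for the trace: a density matrix has purity at least the inverse of its
dimension. -/
lemma norm_trace_sq_le {m : ℕ} (W : Matrix (Fin m) (Fin m) ℂ) :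
    ‖W.trace‖ ^ 2 ≤ m * ∑ a, ∑ b, ‖W a b‖ ^ 2 := by
  calc ‖W.trace‖ ^ 2 ≤ (∑ a, ‖W a a‖) ^ 2 := by
        gcongr
        exact norm_sum_le _ _
    _ ≤ m * ∑ a, ‖W a a‖ ^ 2 := by
        simpa using sq_sum_le_card_mul_sum_sq (s := Finset.univ) (f := fun a => ‖W a a‖)
    _ ≤ m * ∑ a, ∑ b, ‖W a b‖ ^ 2 := by
        gcongr with a
        exact Finset.single_le_sum (f := fun b => ‖W a b‖ ^ 2) (fun _ _ => sq_nonneg _)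
          (Finset.mem_univ a)

/-- The correlation bound for an unnormalised pure state. -/
lemma pure_correlation_bound {m n : ℕ} (hm : 0 < m) (hn : 0 < n)
    (lamJ : Fin (m ^ 2 - 1) → Matrix (Fin m) (Fin m) ℂ)
    (lamK : Fin (n ^ 2 - 1) → Matrix (Fin n) (Fin n) ℂ)
    (hhermJ : ∀ i, (lamJ i).IsHermitian) (hhermK : ∀ i, (lamK i).IsHermitian)
    (htr0J : ∀ i, (lamJ i).trace = 0) (htr0K : ∀ i, (lamK i).trace = 0)
    (horthJ : ∀ i j, (lamJ i * lamJ j).trace = if i = j then 2 else 0)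
    (horthK : ∀ i j, (lamK i * lamK j).trace = if i = j then 2 else 0)
    (ψ : Fin m × Fin n → ℂ) :
    ∑ i : Fin (m ^ 2 - 1) × Fin (n ^ 2 - 1),
        ‖(vecMulVec (star ψ) ψ * (lamJ i.1 ⊗ₖ lamK i.2)).trace‖ ^ 2
      ≤ 4 * ((m : ℝ) ^ 2 - 1) / (m : ℝ) ^ 2 * (∑ x, ‖ψ x‖ ^ 2) ^ 2 := by
  have parsevalJ := sum_norm_sq_trace_generator_mul hm lamJ hhermJ htr0J horthJ
  have parsevalK := sum_norm_sq_trace_generator_mul hn lamK hhermK htr0K horthK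
  have hmR : (0 : ℝ) < m := by exact_mod_cast hm
  have hnR : (0 : ℝ) < n := by exact_mod_cast hn
  let Z : Fin n → Fin n → Matrix (Fin m) (Fin m) ℂ := fun k l =>
    Matrix.of fun a b => star (ψ (a, k)) * ψ (b, l)
  let Y : Fin (m ^ 2 - 1) → Matrix (Fin n) (Fin n) ℂ := fun i =>
    Matrix.of fun k l => (lamJ i * Z k l).trace
  let W : Matrix (Fin m) (Fin m) ℂ := Matrix.of fun a b => ∑ k, star (ψ (a, k)) * ψ (b, k)
  set N := ∑ x, ‖ψ x‖ ^ 2 with hN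
  set p := ∑ a, ∑ b, ‖W a b‖ ^ 2 with hp
  have trace_eq : ∀ i j, (vecMulVec (star ψ) ψ * (lamJ i ⊗ₖ lamK j)).trace =
      (lamK j * Y i).trace := by
    intro i j
    simp only [Matrix.trace, Matrix.diag, Matrix.mul_apply, vecMulVec_apply, kroneckerMap_apply,
      Fintype.sum_prod_type, Y, Z, Matrix.of_apply, Pi.star_apply, Finset.mul_sum]
    let F : Fin n → Fin n → Fin m → Fin m → ℂ := fun k l b a =>
      star (ψ (a, l)) * ψ (b, k) * (lamJ i b a * lamK j k l)
    calc _ = ∑ a, ∑ l, ∑ b, ∑ k, F k l b a := rfl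
      _ = ∑ l, ∑ a, ∑ k, ∑ b, F k l b a := by
          rw [Finset.sum_comm]
          exact Finset.sum_congr rfl fun l _ => Finset.sum_congr rfl fun a _ => Finset.sum_comm
      _ = ∑ l, ∑ k, ∑ b, ∑ a, F k l b a := Finset.sum_congr rfl fun l _ => by
          rw [Finset.sum_comm]
          exact Finset.sum_congr rfl fun k _ => Finset.sum_comm
      _ = ∑ k, ∑ l, ∑ b, ∑ a, F k l b a := Finset.sum_comm
      _ = _ := by
          refine Finset.sum_congr rfl fun k _ => Finset.sum_congr rfl fun l _ =>
            Finset.sum_congr rfl fun b _ => Finset.sum_congr rfl fun a _ => ?_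
          ring
  have trace_Y : ∀ i, (Y i).trace = (lamJ i * W).trace := by
    intro i
    simp only [Matrix.trace, Matrix.diag, Matrix.mul_apply, Y, Z, W, Matrix.of_apply,
      Finset.mul_sum]
    rw [Finset.sum_comm]
    exact Finset.sum_congr rfl fun a _ => Finset.sum_comm
  have trace_W : ‖W.trace‖ = N := by
    have : W.trace = (N : ℂ) := by
      simp only [Matrix.trace, Matrix.diag, W, Matrix.of_apply, hN, Fintype.sum_prod_type,
        RCLike.star_def, Complex.conj_mul']
      push_cast
      rfl
    rw [this, Complex.norm_real, Real.norm_of_nonneg]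
    exact Finset.sum_nonneg fun _ _ => sq_nonneg _
  have sum_Z : ∑ k, ∑ l, ∑ a, ∑ b, ‖Z k l a b‖ ^ 2 = N ^ 2 := by
    simp only [Z, Matrix.of_apply, norm_mul, norm_star, mul_pow, ← Finset.mul_sum,
      ← Finset.sum_mul]
    rw [hN, Fintype.sum_prod_type_right, sq]
  have sum_trace_Z : ∑ k, ∑ l, ‖(Z k l).trace‖ ^ 2 = p :=
    sum_norm_sq_reduced_eq (Matrix.of fun a k => ψ (a, k))
  have sum_Y : ∑ i, ∑ k, ∑ l, ‖Y i k l‖ ^ 2 = 2 * N ^ 2 - 2 / m * p := by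
    calc _ = ∑ k, ∑ l, ∑ i, ‖(lamJ i * Z k l).trace‖ ^ 2 := by
          rw [Finset.sum_comm]
          exact Finset.sum_congr rfl fun k _ => Finset.sum_comm
      _ = _ := by
          simp only [parsevalJ, Finset.sum_sub_distrib, ← Finset.mul_sum, sum_Z, sum_trace_Z]
  have purity : N ^ 2 ≤ m * p := by
    rw [← trace_W]
    exact norm_trace_sq_le W
  have total : ∑ i : Fin (m ^ 2 - 1) × Fin (n ^ 2 - 1),
      ‖(vecMulVec (star ψ) ψ * (lamJ i.1 ⊗ₖ lamK i.2)).trace‖ ^ 2 =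
      2 * (2 * N ^ 2 - 2 / m * p) - 2 / n * (2 * p - 2 / m * N ^ 2) := by
    simp only [Fintype.sum_prod_type, trace_eq, parsevalK, Finset.sum_sub_distrib,
      ← Finset.mul_sum, sum_Y, trace_Y, parsevalJ, trace_W, ← hp]
  have hp_ge : N ^ 2 / m ≤ p := by
    rw [div_le_iff₀ hmR]
    linarith
  rw [total]
  have key : 0 ≤ (4 / m + 4 / n) * (p - N ^ 2 / m) :=
    mul_nonneg (by positivity) (sub_nonneg.2 hp_ge)
  have split : 4 * ((m : ℝ) ^ 2 - 1) / (m : ℝ) ^ 2 * N ^ 2 -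
      (2 * (2 * N ^ 2 - 2 / m * p) - 2 / n * (2 * p - 2 / m * N ^ 2)) =
      (4 / m + 4 / n) * (p - N ^ 2 / m) := by
    field_simp
    ring
  linarith

/-- For any bipartite density matrix ρ on H_j ⊗ H_k with 2 ≤ d_j ≤ d_k, the correlation
tensor with entries Tr(ρ (λ_{i_j} ⊗ λ_{i_k})) satisfies ∑ t² ≤ 4(d_j² − 1)/d_j². -/
theorem bipartite_correlation_bound (dj dk : ℕ) (hdj : 2 ≤ dj) (hjk : dj ≤ dk)
    (ρ : Matrix (Fin dj × Fin dk) (Fin dj × Fin dk) ℂ)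
    (hρ : ρ.PosSemidef) (hρtr : ρ.trace = 1)
    (lamJ : Fin (dj ^ 2 - 1) → Matrix (Fin dj) (Fin dj) ℂ)
    (lamK : Fin (dk ^ 2 - 1) → Matrix (Fin dk) (Fin dk) ℂ)
    (hhermJ : ∀ i, (lamJ i).IsHermitian) (hhermK : ∀ i, (lamK i).IsHermitian)
    (htr0J : ∀ i, (lamJ i).trace = 0) (htr0K : ∀ i, (lamK i).trace = 0)
    (horthJ : ∀ i j, (lamJ i * lamJ j).trace = if i = j then 2 else 0)
    (horthK : ∀ i j, (lamK i * lamK j).trace = if i = j then 2 else 0) :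
    ∑ i : Fin (dj ^ 2 - 1) × Fin (dk ^ 2 - 1),
        ‖(ρ * (lamJ i.1 ⊗ₖ lamK i.2)).trace‖ ^ 2
      ≤ 4 * ((dj : ℝ) ^ 2 - 1) / (dj : ℝ) ^ 2 := by
  have hdj0 : 0 < dj := by omega
  have hc : (0 : ℝ) ≤ 4 * ((dj : ℝ) ^ 2 - 1) / (dj : ℝ) ^ 2 := by
    have : (2 : ℝ) ≤ dj := by exact_mod_cast hdj
    have : (0 : ℝ) ≤ (dj : ℝ) ^ 2 - 1 := by nlinarith
    positivity
  obtain ⟨r, v, rfl⟩ := Matrix.posSemidef_iff_eq_sum_vecMulVec.mp hρ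
  set c := 4 * ((dj : ℝ) ^ 2 - 1) / (dj : ℝ) ^ 2
  let T : Matrix (Fin dj × Fin dk) (Fin dj × Fin dk) ℂ →
      EuclideanSpace ℂ (Fin (dj ^ 2 - 1) × Fin (dk ^ 2 - 1)) :=
    fun σ => WithLp.toLp 2 fun i => (σ * (lamJ i.1 ⊗ₖ lamK i.2)).trace
  have T_sum : T (∑ a, vecMulVec (v a) (star (v a))) = ∑ a, T (vecMulVec (v a) (star (v a))) := by
    ext i
    simp [T, Finset.sum_mul, Matrix.trace_sum]
  have T_pure : ∀ a, ‖T (vecMulVec (v a) (star (v a)))‖ ≤ √c * ∑ x, ‖v a x‖ ^ 2 := by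
    intro a
    refine le_of_sq_le_sq ?_ (by positivity)
    rw [EuclideanSpace.norm_sq_eq, mul_pow, Real.sq_sqrt hc]
    simpa using pure_correlation_bound hdj0 (hdj0.trans_le hjk) lamJ lamK hhermJ hhermK htr0J htr0K
      horthJ horthK (star (v a))
  have norm_v : ∑ a, ∑ x, ‖v a x‖ ^ 2 = 1 := by
    apply Complex.ofReal_injective
    rw [Complex.ofReal_one, ← hρtr, Matrix.trace_sum]
    push_cast
    simp [Matrix.trace_vecMulVec, dotProduct, Complex.mul_conj']
  have T_le : ‖T (∑ a, vecMulVec (v a) (star (v a)))‖ ≤ √c := by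
    rw [T_sum]
    calc _ ≤ ∑ a, ‖T (vecMulVec (v a) (star (v a)))‖ := norm_sum_le _ _
      _ ≤ ∑ a, √c * ∑ x, ‖v a x‖ ^ 2 := Finset.sum_le_sum fun a _ => T_pure a
      _ = √c := by rw [← Finset.mul_sum, norm_v, mul_one]
  calc _ = ‖T (∑ a, vecMulVec (v a) (star (v a)))‖ ^ 2 := (EuclideanSpace.norm_sq_eq _).symm
    _ ≤ √c ^ 2 := by gcongr
    _ = c := Real.sq_sqrt hc
end

section
/- For any n-qudit density matrix ρ on (ℂ^d)^{⊗n} with n ≥ 3 and d ≥ 2, the full correlation tensor satisfies ‖T^{(12⋯n)}‖² ≤ 2^n ((n−2)d^n − n d^{n−2} + 2)/((n−2) d^n). -/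
open Matrix BigOperators ComplexOrder

/-- The Kronecker (tensor) product of a finite family of square matrices, given entrywise. -/
def famKron {ι : Type*} [Fintype ι] {dims : ι → ℕ}
    (M : ∀ k, Matrix (Fin (dims k)) (Fin (dims k)) ℂ) :
    Matrix (∀ k, Fin (dims k)) (∀ k, Fin (dims k)) ℂ :=
  fun a b => ∏ k, M k (a k) (b k)

/-- Square matrices indexed by `ι` that are orthonormal for the Hilbert–Schmidt inner product, and
as many as the dimension, satisfy the completeness relation. -/
theorem sum_mul_star_eq_of_orthonormal {ι κ : Type*} [Fintype ι] [DecidableEq ι] [Fintype κ]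
    [DecidableEq κ] (μ : ι → Matrix κ κ ℂ)
    (hcard : Fintype.card ι = Fintype.card (κ × κ))
    (horth : ∀ i j, (μ i * (μ j)ᴴ).trace = if i = j then 1 else 0) (a b c e : κ) :
    ∑ i, μ i a b * star (μ i c e) = (if a = c then 1 else 0) * (if b = e then 1 else 0) := by
  let U : Matrix ι (κ × κ) ℂ := Matrix.of fun i p => μ i p.1 p.2
  have hU : U * Uᴴ = 1 := by
    ext i j
    rw [Matrix.one_apply, ← horth i j]
    simp [U, Matrix.mul_apply, Matrix.trace, Fintype.sum_prod_type]
  have hU' : Uᴴ * U = 1 := (Matrix.mul_eq_one_comm_of_card_eq _ _ _ hcard).1 hU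
  have h := congrFun (congrFun hU' (c, e)) (a, b)
  simp only [U, Matrix.mul_apply, Matrix.conjTranspose_apply, Matrix.of_apply, Matrix.one_apply,
    Prod.mk.injEq] at h
  simp_rw [mul_comm (μ _ a b), h, eq_comm (a := a), eq_comm (a := b)]
  by_cases h1 : c = a <;> by_cases h2 : e = b <;> simp [h1, h2]

/-- The correlations of the vector `ψ` with the tensor products of a family `μ`. -/
noncomputable def vecCorr {n d : ℕ} {ι : Type*} (μ : ι → Matrix (Fin d) (Fin d) ℂ)
    (ψ : (Fin n → Fin d) → ℂ) (i : Fin n → ι) : ℂ :=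
  (Matrix.vecMulVec ψ (star ψ) * famKron (dims := fun _ : Fin n => d) fun k => μ (i k)).trace

/-- The site-factorised contraction of `ψ ⊗ ψ* ⊗ ψ ⊗ ψ*` with a kernel. -/
noncomputable def vecContr {n d : ℕ} (K : Fin n → Fin d → Fin d → Fin d → Fin d → ℂ)
    (ψ : (Fin n → Fin d) → ℂ) : ℂ :=
  ∑ a, ∑ b, ∑ c, ∑ e, ψ b * star (ψ a) * (ψ c * star (ψ e)) * ∏ k, K k (a k) (b k) (c k) (e k)

theorem vecContr_swap {n d : ℕ} (K : Fin n → Fin d → Fin d → Fin d → Fin d → ℂ)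
    (ψ : (Fin n → Fin d) → ℂ) :
    vecContr (fun k a b c e => K k a c b e) ψ = vecContr K ψ := by
  unfold vecContr
  refine Finset.sum_congr rfl fun a _ => ?_
  rw [Finset.sum_comm]
  refine Finset.sum_congr rfl fun b _ => Finset.sum_congr rfl fun c _ =>
    Finset.sum_congr rfl fun e _ => ?_
  ring

theorem vecContr_const_mul {n d : ℕ} (r : Fin n → ℂ)
    (K : Fin n → Fin d → Fin d → Fin d → Fin d → ℂ) (ψ : (Fin n → Fin d) → ℂ) :
    vecContr (fun k a b c e => r k * K k a b c e) ψ = (∏ k, r k) * vecContr K ψ := by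
  simp only [vecContr, Finset.prod_mul_distrib, Finset.mul_sum]
  refine Finset.sum_congr rfl fun a _ => Finset.sum_congr rfl fun b _ =>
    Finset.sum_congr rfl fun c _ => Finset.sum_congr rfl fun e _ => ?_
  ring

theorem vecContr_delta {n d : ℕ} (ψ : (Fin n → Fin d) → ℂ) :
    vecContr (fun _ a b c e => (if a = c then 1 else 0) * (if b = e then 1 else 0)) ψ
      = ((∑ a, ‖ψ a‖ ^ 2 : ℝ) : ℂ) ^ 2 := by
  have h (x y : Fin n → Fin d) :
      (∏ k, if x k = y k then (1 : ℂ) else 0) = if x = y then 1 else 0 := by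
    simp [Finset.prod_ite_zero, funext_iff]
  have hn (x : Fin n → Fin d) : ((‖ψ x‖ ^ 2 : ℝ) : ℂ) = ψ x * star (ψ x) := by
    simp [Complex.mul_conj, Complex.normSq_eq_norm_sq]
  simp only [vecContr, Finset.prod_mul_distrib, h, Complex.ofReal_sum, hn,
    sq (∑ _, _), Finset.sum_mul_sum]
  refine Finset.sum_congr rfl fun a _ => Finset.sum_congr rfl fun b _ => ?_
  simp only [mul_ite, mul_one, mul_zero, Finset.sum_ite_eq, Finset.mem_univ, if_true]
  ring

theorem sum_prod_mul_norm_vecCorr_sq {n d : ℕ} {ι : Type*} [Fintype ι] [DecidableEq ι]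
    (μ : ι → Matrix (Fin d) (Fin d) ℂ) (w : Fin n → ι → ℂ) (ψ : (Fin n → Fin d) → ℂ) :
    ∑ i : Fin n → ι, (∏ k, w k (i k)) * ((‖vecCorr μ ψ i‖ ^ 2 : ℝ) : ℂ)
      = vecContr (fun k a b c e => ∑ j, w k j * (μ j a b * star (μ j c e))) ψ := by
  have hc (i : Fin n → ι) : vecCorr μ ψ i
      = ∑ a, ∑ b, ψ b * star (ψ a) * ∏ k, μ (i k) (a k) (b k) := by
    rw [Finset.sum_comm]
    simp [vecCorr, Matrix.trace, Matrix.mul_apply, Matrix.vecMulVec_apply, famKron]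
  have hn (z : ℂ) : ((‖z‖ ^ 2 : ℝ) : ℂ) = z * star z := by
    simp [Complex.mul_conj, Complex.normSq_eq_norm_sq]
  have hsq (i : Fin n → ι) : vecCorr μ ψ i * star (vecCorr μ ψ i)
      = ∑ a, ∑ b, ∑ c, ∑ e, (ψ b * star (ψ a) * ∏ k, μ (i k) (a k) (b k)) *
          star (ψ e * star (ψ c) * ∏ k, μ (i k) (c k) (e k)) := by
    simp only [hc, star_sum, Finset.sum_mul]
    simp only [Finset.mul_sum]
  simp only [vecContr, hn, hsq, Finset.prod_univ_sum, Fintype.piFinset_univ,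
    Finset.mul_sum, star_mul', star_star, star_prod]
  rw [Finset.sum_comm]
  refine Finset.sum_congr rfl fun a _ => ?_
  rw [Finset.sum_comm]
  refine Finset.sum_congr rfl fun b _ => ?_
  rw [Finset.sum_comm]
  refine Finset.sum_congr rfl fun c _ => ?_
  rw [Finset.sum_comm]
  refine Finset.sum_congr rfl fun e _ => ?_
  refine Finset.sum_congr rfl fun i _ => ?_
  simp only [Finset.prod_mul_distrib]
  ring

/-- Counting inequality between the sectors of a string `i`, according to its number of `none`s. -/
theorem sector_indicator_le {n : ℕ} (hn : 3 ≤ n) {α : Type*} [DecidableEq α]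
    (i : Fin n → Option α) :
    ((n : ℝ) - 2) * (if ∀ k, i k ≠ none then 1 else 0) + ∑ k, (if i k = none then (1 : ℝ) else 0)
      ≤ ((n : ℝ) - 2) + ∑ k, (if ∀ j, j ≠ k → i j = none then (1 : ℝ) else 0)
        - ((n : ℝ) - 2) * (if ∀ k, i k = none then 1 else 0) := by
  have hn' : (3 : ℝ) ≤ n := by exact_mod_cast hn
  by_cases h0 : ∀ k, i k = none
  · have : ¬ ∀ k, i k ≠ none := fun h => h ⟨0, by omega⟩ (h0 _)
    have : Nonempty (Fin n) := ⟨⟨0, by omega⟩⟩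
    simp [h0]
  have hg : (0 : ℝ) ≤ ∑ k, (if ∀ j, j ≠ k → i j = none then (1 : ℝ) else 0) :=
    Finset.sum_nonneg fun k _ => by split_ifs <;> norm_num
  by_cases h1 : ∀ k, i k ≠ none
  · rw [if_pos h1, if_neg h0, Finset.sum_congr rfl fun k _ => if_neg (h1 k)]
    simp only [Finset.sum_const_zero]
    linarith
  push Not at h0
  obtain ⟨k, hk⟩ := h0
  have hnk : ¬ ∀ k, i k = none := fun h => hk (h k)
  rw [if_neg h1, if_neg hnk]
  rw [Finset.sum_boole]
  by_cases h2 : ∀ j, j ≠ k → i j = none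
  · have h3 : (1 : ℝ) ≤ ∑ k, (if ∀ j, j ≠ k → i j = none then (1 : ℝ) else 0) := by
      refine le_trans ?_ (Finset.single_le_sum (fun k _ => ?_) (Finset.mem_univ k))
      · rw [if_pos h2]
      · split_ifs <;> norm_num
    have h4 : ((Finset.univ.filter fun k => i k = none).card : ℝ) ≤ n - 1 := by
      have : (Finset.univ.filter fun k => i k = none) ⊆ Finset.univ.erase k := by
        intro j hj
        have hj' : i j = none := by simpa using hj
        simp only [Finset.mem_erase, Finset.mem_univ, and_true]
        rintro rfl
        exact hk hj'
      have := Finset.card_le_card this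
      rw [Finset.card_erase_of_mem (Finset.mem_univ _), Finset.card_univ, Fintype.card_fin] at this
      have : (Finset.univ.filter fun k => i k = none).card + 1 ≤ n := by omega
      have : ((Finset.univ.filter fun k => i k = none).card : ℝ) + 1 ≤ n := by exact_mod_cast this
      linarith
    linarith
  · push Not at h2
    obtain ⟨l, hl, hil⟩ := h2
    have h4 : ((Finset.univ.filter fun k => i k = none).card : ℝ) ≤ n - 2 := by
      have : (Finset.univ.filter fun k => i k = none) ⊆ (Finset.univ.erase k).erase l := by
        intro j hj
        have hj' : i j = none := by simpa using hj
        simp only [Finset.mem_erase, Finset.mem_univ, and_true]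
        exact ⟨fun h => hil (h ▸ hj'), fun h => hk (h ▸ hj')⟩
      have := Finset.card_le_card this
      rw [Finset.card_erase_of_mem (by simp [hl]), Finset.card_erase_of_mem (Finset.mem_univ _),
        Finset.card_univ, Fintype.card_fin] at this
      have : (Finset.univ.filter fun k => i k = none).card + 2 ≤ n := by omega
      have : ((Finset.univ.filter fun k => i k = none).card : ℝ) + 2 ≤ n := by exact_mod_cast this
      linarith
    linarith

/-- The scaled identity together with the rescaled generators. -/
noncomputable def extendedBasis {d : ℕ} {ι : Type*} (lam : ι → Matrix (Fin d) (Fin d) ℂ) :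
    Option ι → Matrix (Fin d) (Fin d) ℂ
  | none => ((Real.sqrt d)⁻¹ : ℂ) • 1
  | some i => ((Real.sqrt 2)⁻¹ : ℂ) • lam i

theorem extendedBasis_complete {d : ℕ} (hd : 2 ≤ d)
    (lam : Fin (d ^ 2 - 1) → Matrix (Fin d) (Fin d) ℂ)
    (hherm : ∀ i, (lam i).IsHermitian)
    (htr0 : ∀ i, (lam i).trace = 0)
    (horth : ∀ i j, (lam i * lam j).trace = if i = j then 2 else 0) (a b c e : Fin d) :
    ∑ i, extendedBasis lam i a b * star (extendedBasis lam i c e)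
      = (if a = c then 1 else 0) * (if b = e then 1 else 0) := by
  have hs2 : ((Real.sqrt 2 : ℝ) : ℂ) * (Real.sqrt 2 : ℝ) = 2 := by
    rw [← Complex.ofReal_mul, Real.mul_self_sqrt (by norm_num)]; simp
  have hsd : ((Real.sqrt d : ℝ) : ℂ) * (Real.sqrt d : ℝ) = d := by
    rw [← Complex.ofReal_mul, Real.mul_self_sqrt (by positivity)]; simp
  have hd0 : (d : ℂ) ≠ 0 := by exact_mod_cast (by omega : d ≠ 0)
  refine sum_mul_star_eq_of_orthonormal _ ?_ ?_ a b c e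
  · have : 0 < d ^ 2 := by positivity
    simp only [Fintype.card_option, Fintype.card_fin, Fintype.card_prod, ← sq]
    omega
  · rintro (_ | i) (_ | j)
    · simp [extendedBasis, ← mul_inv, ← mul_assoc, hsd, hd0]
    · simp [extendedBasis, (hherm j).eq, htr0]
    · simp [extendedBasis, htr0]
    · simp only [extendedBasis, Matrix.conjTranspose_smul, (hherm j).eq, Matrix.smul_mul,
        Matrix.mul_smul, Matrix.trace_smul, horth, smul_eq_mul, Option.some.injEq]
      split_ifs
      · simp [← mul_assoc, ← mul_inv, hs2]
      · simp

theorem sum_norm_vecCorr_extendedBasis_le {n d : ℕ} (hn : 3 ≤ n) (hd : 2 ≤ d)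
    (lam : Fin (d ^ 2 - 1) → Matrix (Fin d) (Fin d) ℂ)
    (hherm : ∀ i, (lam i).IsHermitian)
    (htr0 : ∀ i, (lam i).trace = 0)
    (horth : ∀ i j, (lam i * lam j).trace = if i = j then 2 else 0) (ψ : (Fin n → Fin d) → ℂ) :
    ((n : ℝ) - 2) * (d : ℝ) ^ n *
        ∑ i, (if ∀ k, i k ≠ none then 1 else 0) * ‖vecCorr (extendedBasis lam) ψ i‖ ^ 2
      ≤ (((n : ℝ) - 2) * (d : ℝ) ^ n - (n : ℝ) * (d : ℝ) ^ (n - 2) + 2)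
        * (∑ a, ‖ψ a‖ ^ 2) ^ 2 := by
  set N : ℝ := ∑ a, ‖ψ a‖ ^ 2 with hN
  set A : (Fin n → Option (Fin (d ^ 2 - 1))) → ℝ :=
    fun i => ‖vecCorr (extendedBasis lam) ψ i‖ ^ 2 with hA
  have hA0 (i) : 0 ≤ A i := by positivity
  have hn' : (3 : ℝ) ≤ n := by exact_mod_cast hn
  have hd' : (2 : ℝ) ≤ d := by exact_mod_cast hd
  have hd0 : (d : ℂ) ≠ 0 := by exact_mod_cast (by omega : d ≠ 0)
  have hsd : ((Real.sqrt d : ℝ) : ℂ) * (Real.sqrt d : ℝ) = d := by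
    rw [← Complex.ofReal_mul, Real.mul_self_sqrt (by positivity)]; simp
  have hcomp := extendedBasis_complete hd lam hherm htr0 horth
  have hnone (a b c e : Fin d) : ∑ j, (if j = none then 1 else 0) *
      (extendedBasis lam j a b * star (extendedBasis lam j c e))
      = (d : ℂ)⁻¹ * ((if a = b then 1 else 0) * (if c = e then 1 else 0)) := by
    simp only [ite_mul, one_mul, zero_mul, Finset.sum_ite_eq', Finset.mem_univ, if_true]
    simp only [extendedBasis, Matrix.smul_apply, Matrix.one_apply, smul_eq_mul, star_mul',
      ← hsd, mul_inv]
    have h1 : star ((Real.sqrt d : ℂ))⁻¹ = ((Real.sqrt d : ℂ))⁻¹ := by simp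
    rw [h1]
    by_cases h1 : a = b <;> by_cases h2 : c = e <;> simp [h1, h2]
  have key (s : Fin n → Prop) [DecidablePred s] :
      ((∑ i, (if ∀ k, s k → i k = none then 1 else 0) * A i : ℝ) : ℂ)
        = (∏ k, if s k then (d : ℂ)⁻¹ else 1) * vecContr (fun k a b c e => if s k then
            ((if a = b then 1 else 0) * (if c = e then 1 else 0)) else
            ((if a = c then 1 else 0) * (if b = e then 1 else 0))) ψ := by
    rw [← vecContr_const_mul]
    have := sum_prod_mul_norm_vecCorr_sq (extendedBasis lam)
      (fun k j => if s k → j = none then 1 else 0) ψ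
    have h2 : (fun (k : Fin n) (a b c e : Fin d) => ∑ j, (if s k → j = none then (1 : ℂ) else 0) *
        (extendedBasis lam j a b * star (extendedBasis lam j c e)))
        = fun k a b c e => (if s k then (d : ℂ)⁻¹ else 1) * (if s k then
            ((if a = b then 1 else 0) * (if c = e then 1 else 0)) else
            ((if a = c then 1 else 0) * (if b = e then 1 else 0))) := by
      funext k a b c e
      by_cases hs : s k
      · simpa only [hs, if_true, true_imp_iff] using hnone a b c e
      · simpa only [hs, if_false, false_imp_iff, if_true, one_mul] using hcomp a b c e
    rw [h2] at this
    rw [← this, Complex.ofReal_sum]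
    refine Finset.sum_congr rfl fun i _ => ?_
    rw [Complex.ofReal_mul, Finset.prod_ite_zero]
    simp only [hA, apply_ite Complex.ofReal, Complex.ofReal_one, Complex.ofReal_zero,
      Finset.mem_univ, true_imp_iff, Finset.prod_const_one]
  have htot : ∑ i, A i = N ^ 2 := by
    have := key (fun _ => False)
    simp only [false_imp_iff, implies_true, if_true, one_mul, if_false, Finset.prod_const_one,
      vecContr_delta] at this
    exact_mod_cast this
  have hzero : (d : ℝ) ^ n * ∑ i, (if ∀ k, i k = none then 1 else 0) * A i = N ^ 2 := by
    have := key (fun _ => True)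
    simp only [true_imp_iff, if_true, Finset.prod_const, Finset.card_univ, Fintype.card_fin] at this
    rw [← vecContr_swap, vecContr_delta] at this
    have h3 : (d : ℂ) ^ n * ((∑ i, (if ∀ k, i k = none then 1 else 0) * A i : ℝ) : ℂ)
        = (N : ℂ) ^ 2 := by
      rw [this, ← mul_assoc, ← mul_pow, mul_inv_cancel₀ hd0]; simp [hN]
    exact_mod_cast h3
  have hsite (k : Fin n) : ∑ i, (if i k = none then 1 else 0) * A i
      = (d : ℝ) ^ (n - 2) * ∑ i, (if ∀ j, j ≠ k → i j = none then 1 else 0) * A i := by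
    have h1 := key (fun j => j = k)
    have h2 := key (fun j => j ≠ k)
    rw [← vecContr_swap] at h2
    have h3 : (fun (k' : Fin n) (a b c e : Fin d) => if k' ≠ k then
            ((if a = c then (1 : ℂ) else 0) * (if b = e then 1 else 0)) else
            ((if a = b then 1 else 0) * (if c = e then 1 else 0)))
        = fun (k' : Fin n) (a b c e : Fin d) => if k' = k then
            ((if a = b then (1 : ℂ) else 0) * (if c = e then 1 else 0)) else
            ((if a = c then 1 else 0) * (if b = e then 1 else 0)) := by
      funext k' a b c e
      by_cases h : k' = k <;> simp [h]
    rw [h3] at h2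
    have h4 : (∏ j, if j = k then (d : ℂ)⁻¹ else 1) = (d : ℂ)⁻¹ := by simp
    have h5 : (∏ j, if j ≠ k then (d : ℂ)⁻¹ else 1) = ((d : ℂ)⁻¹) ^ (n - 1) := by
      rw [← Finset.prod_filter, Finset.prod_const, Finset.filter_ne']
      simp
    rw [h4] at h1
    rw [h5] at h2
    have h6 : ((d : ℂ)) ^ (n - 2) * ((d : ℂ)⁻¹) ^ (n - 1) = (d : ℂ)⁻¹ := by
      have : n - 1 = (n - 2) + 1 := by omega
      rw [this, pow_succ, ← mul_assoc, ← mul_pow, mul_inv_cancel₀ hd0]; simp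
    have h7 : ((∑ i, (if ∀ j, j = k → i j = none then 1 else 0) * A i : ℝ) : ℂ)
      = (d : ℂ) ^ (n - 2) *
        ((∑ i, (if ∀ j, j ≠ k → i j = none then 1 else 0) * A i : ℝ) : ℂ) := by
      rw [h1, h2, ← mul_assoc, h6]
    simp only [forall_eq] at h7
    exact_mod_cast h7
  set Z := ∑ i, (if ∀ k, i k = none then 1 else 0) * A i with hZ
  set G := ∑ k, ∑ i, (if ∀ j, j ≠ k → i j = none then 1 else 0) * A i with hG
  set F := ∑ i, (if ∀ k, i k ≠ none then 1 else 0) * A i with hF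
  have hGZ : n * Z ≤ G := by
    have : ∑ _k : Fin n, Z ≤ G := by
      refine Finset.sum_le_sum fun k _ => Finset.sum_le_sum fun i _ => ?_
      refine mul_le_mul_of_nonneg_right ?_ (hA0 i)
      by_cases h : ∀ k, i k = none
      · simp [h]
      · rw [if_neg h]; split_ifs <;> norm_num
    simpa using this
  have hsum : ((n : ℝ) - 2) * F + (d : ℝ) ^ (n - 2) * G
      ≤ ((n : ℝ) - 2) * N ^ 2 + G - ((n : ℝ) - 2) * Z := by
    have h := Finset.sum_le_sum fun i (_ : i ∈ Finset.univ) =>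
      mul_le_mul_of_nonneg_right (sector_indicator_le hn i) (hA0 i)
    have hG' : (d : ℝ) ^ (n - 2) * G = ∑ k, ∑ i, (if i k = none then 1 else 0) * A i := by
      rw [hG, Finset.mul_sum]
      exact Finset.sum_congr rfl fun k _ => (hsite k).symm
    rw [hG', ← htot, hF, hG, hZ]
    simp_rw [add_mul, sub_mul _ _ (A _), add_mul, Finset.sum_sub_distrib, Finset.sum_add_distrib,
      Finset.sum_mul, mul_assoc, ← Finset.mul_sum] at h
    have hcomm (f : (Fin n → Option (Fin (d ^ 2 - 1))) → Fin n → ℝ) :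
        ∑ i, ∑ k, f i k = ∑ k, ∑ i, f i k := Finset.sum_comm
    rwa [hcomm fun i k => (if i k = none then 1 else 0) * A i,
      hcomm fun i k => (if ∀ j, j ≠ k → i j = none then 1 else 0) * A i] at h
  have hp : (1 : ℝ) ≤ (d : ℝ) ^ (n - 2) := one_le_pow₀ (by linarith)
  have h1 := mul_le_mul_of_nonneg_left hGZ (sub_nonneg.2 hp)
  have h2 : ((n : ℝ) - 2) * F ≤ ((n : ℝ) - 2) * N ^ 2 + 2 * Z - n * (d : ℝ) ^ (n - 2) * Z := by
    linarith
  have h3 := mul_le_mul_of_nonneg_left h2 (by positivity : (0 : ℝ) ≤ (d : ℝ) ^ n)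
  calc _ = (d : ℝ) ^ n * (((n : ℝ) - 2) * F) := by ring
    _ ≤ _ := h3
    _ = ((n : ℝ) - 2) * d ^ n * N ^ 2 + (2 - n * (d : ℝ) ^ (n - 2)) * ((d : ℝ) ^ n * Z) := by ring
    _ = _ := by rw [hzero]; ring

theorem sum_norm_vecCorr_sq_le {n d : ℕ} (hn : 3 ≤ n) (hd : 2 ≤ d)
    (lam : Fin (d ^ 2 - 1) → Matrix (Fin d) (Fin d) ℂ)
    (hherm : ∀ i, (lam i).IsHermitian)
    (htr0 : ∀ i, (lam i).trace = 0)
    (horth : ∀ i j, (lam i * lam j).trace = if i = j then 2 else 0) (ψ : (Fin n → Fin d) → ℂ) :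
    ∑ i, ‖vecCorr lam ψ i‖ ^ 2
      ≤ 2 ^ n * (((n : ℝ) - 2) * (d : ℝ) ^ n - (n : ℝ) * (d : ℝ) ^ (n - 2) + 2)
          / (((n : ℝ) - 2) * (d : ℝ) ^ n) * (∑ a, ‖ψ a‖ ^ 2) ^ 2 := by
  have h := sum_norm_vecCorr_extendedBasis_le hn hd lam hherm htr0 horth ψ
  have hn' : (3 : ℝ) ≤ n := by exact_mod_cast hn
  have hd' : (2 : ℝ) ≤ d := by exact_mod_cast hd
  have hscale (i : Fin n → Fin (d ^ 2 - 1)) :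
      ‖vecCorr (extendedBasis lam) ψ fun k => some (i k)‖ ^ 2
        = (2 ^ n)⁻¹ * ‖vecCorr lam ψ i‖ ^ 2 := by
    have : vecCorr (extendedBasis lam) ψ (fun k => some (i k))
        = ((Real.sqrt 2)⁻¹ : ℂ) ^ n * vecCorr lam ψ i := by
      simp only [vecCorr, ← smul_eq_mul (_ ^ n), ← Matrix.trace_smul, ← Matrix.mul_smul]
      congr 2
      ext a b
      simp [famKron, extendedBasis, Finset.prod_mul_distrib]
    rw [this, norm_mul, mul_pow, norm_pow, ← pow_mul, mul_comm n 2, pow_mul]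
    congr 1
    rw [norm_inv, Complex.norm_real, inv_pow, inv_pow, Real.norm_eq_abs, sq_abs,
      Real.sq_sqrt (by norm_num)]
  have hsome : ∑ i, (if ∀ k, i k ≠ none then 1 else 0) * ‖vecCorr (extendedBasis lam) ψ i‖ ^ 2
      = (2 ^ n)⁻¹ * ∑ i, ‖vecCorr lam ψ i‖ ^ 2 := by
    simp_rw [Finset.mul_sum, ← hscale, ite_mul, one_mul, zero_mul]
    rw [← Finset.sum_filter]
    symm
    refine Finset.sum_bij (fun i _ k => some (i k)) (by simp) ?_ ?_ (fun _ _ => rfl)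
    · intro i _ j _ hij
      funext k
      simpa using congrFun hij k
    · intro i hi
      simp only [Finset.mem_filter, Finset.mem_univ, true_and] at hi
      choose f hf using fun k => Option.ne_none_iff_exists'.1 (hi k)
      exact ⟨f, Finset.mem_univ _, funext fun k => (hf k).symm⟩
  rw [hsome] at h
  have hc : 0 < ((n : ℝ) - 2) * (d : ℝ) ^ n := mul_pos (by linarith) (by positivity)
  rw [div_mul_eq_mul_div, le_div_iff₀ hc]
  calc _ = 2 ^ n * (((n : ℝ) - 2) * (d : ℝ) ^ n * ((2 ^ n)⁻¹ * ∑ i, ‖vecCorr lam ψ i‖ ^ 2)) := by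
        field_simp
    _ ≤ _ := mul_le_mul_of_nonneg_left h (by positivity)
    _ = _ := by ring

theorem correlation_bound_nonneg {n d : ℕ} (hn : 3 ≤ n) (hd : 2 ≤ d) :
    (0 : ℝ) ≤ 2 ^ n * (((n : ℝ) - 2) * (d : ℝ) ^ n - (n : ℝ) * (d : ℝ) ^ (n - 2) + 2)
          / (((n : ℝ) - 2) * (d : ℝ) ^ n) := by
  have hn' : (3 : ℝ) ≤ n := by exact_mod_cast hn
  have hd' : (2 : ℝ) ≤ d := by exact_mod_cast hd
  have hp : (0 : ℝ) < (d : ℝ) ^ (n - 2) := by positivity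
  have h : (d : ℝ) ^ n = (d : ℝ) ^ (n - 2) * d ^ 2 := by
    rw [← pow_add]; congr 1; omega
  have hc : (0 : ℝ) ≤ ((n : ℝ) - 2) * d ^ 2 - n := by
    nlinarith [mul_nonneg (by linarith : (0 : ℝ) ≤ n - 2)
      (by nlinarith : (0 : ℝ) ≤ (d : ℝ) ^ 2 - 4)]
  have h2 : (0 : ℝ) ≤ ((n : ℝ) - 2) * (d : ℝ) ^ n - (n : ℝ) * (d : ℝ) ^ (n - 2) + 2 := by
    rw [h]; nlinarith [mul_nonneg hp.le hc]
  have h3 : (0 : ℝ) ≤ (n : ℝ) - 2 := by linarith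
  positivity

/-- For any n-qudit density matrix (n ≥ 3, d ≥ 2), the full correlation tensor satisfies
‖T^{(12⋯n)}‖² ≤ 2ⁿ((n−2)dⁿ − n d^{n−2} + 2)/((n−2)dⁿ). -/
theorem nqudit_correlation_bound (n d : ℕ) (hn : 3 ≤ n) (hd : 2 ≤ d)
    (ρ : Matrix (Fin n → Fin d) (Fin n → Fin d) ℂ)
    (hρ : ρ.PosSemidef) (hρtr : ρ.trace = 1)
    (lam : Fin (d ^ 2 - 1) → Matrix (Fin d) (Fin d) ℂ)
    (hherm : ∀ i, (lam i).IsHermitian)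
    (htr0 : ∀ i, (lam i).trace = 0)
    (horth : ∀ i j, (lam i * lam j).trace = if i = j then 2 else 0) :
    ∑ i : Fin n → Fin (d ^ 2 - 1),
        ‖(ρ * famKron (dims := fun _ : Fin n => d) fun k => lam (i k)).trace‖ ^ 2
      ≤ 2 ^ n * (((n : ℝ) - 2) * (d : ℝ) ^ n - (n : ℝ) * (d : ℝ) ^ (n - 2) + 2)
          / (((n : ℝ) - 2) * (d : ℝ) ^ n) := by
  set C : ℝ := 2 ^ n * (((n : ℝ) - 2) * (d : ℝ) ^ n - (n : ℝ) * (d : ℝ) ^ (n - 2) + 2)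
          / (((n : ℝ) - 2) * (d : ℝ) ^ n) with hC
  have hC0 : 0 ≤ C := correlation_bound_nonneg hn hd
  obtain ⟨m, ψ, hρψ⟩ := Matrix.posSemidef_iff_eq_sum_vecMulVec.1 hρ
  have hnorm : ∑ j, ∑ a, ‖ψ j a‖ ^ 2 = 1 := by
    have h : ((∑ j, ∑ a, ‖ψ j a‖ ^ 2 : ℝ) : ℂ) = 1 := by
      rw [← hρtr, hρψ, Matrix.trace_sum, Complex.ofReal_sum]
      refine Finset.sum_congr rfl fun j _ => ?_
      simp [Matrix.trace, Matrix.vecMulVec_apply, Complex.mul_conj, Complex.normSq_eq_norm_sq]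
    exact_mod_cast h
  let T : Fin m → EuclideanSpace ℂ (Fin n → Fin (d ^ 2 - 1)) :=
    fun j => WithLp.toLp 2 (vecCorr lam (ψ j))
  have hT (j) : ‖T j‖ ≤ Real.sqrt C * ∑ a, ‖ψ j a‖ ^ 2 := by
    refine abs_le_of_sq_le_sq' ?_ (by positivity) |>.2
    rw [mul_pow, Real.sq_sqrt hC0, EuclideanSpace.norm_sq_eq]
    exact sum_norm_vecCorr_sq_le hn hd lam hherm htr0 horth (ψ j)
  have hsum : ‖∑ j, T j‖ ≤ Real.sqrt C := by
    refine (norm_sum_le _ _).trans ((Finset.sum_le_sum fun j _ => hT j).trans ?_)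
    rw [← Finset.mul_sum, hnorm, mul_one]
  have hsq : ‖∑ j, T j‖ ^ 2 ≤ C :=
    (pow_le_pow_left₀ (norm_nonneg _) hsum 2).trans (Real.sq_sqrt hC0).le
  rw [EuclideanSpace.norm_sq_eq] at hsq
  refine le_of_eq_of_le (Finset.sum_congr rfl fun i _ => ?_) hsq
  rw [hρψ, Finset.sum_mul, Matrix.trace_sum]
  simp [T, vecCorr]
end

section
/- Let ρ be a (2,2)-separable four-partite state on H_1^{d_1} ⊗ H_2^{d_2} ⊗ H_3^{d_3} ⊗ H_4^{d_4} (2 ≤ d_1 ≤ d_2 ≤ d_3 ≤ d_4), i.e., a convex combination of pure states of the form |φ_{12}⟩ ⊗ |φ_{34}⟩. Then ‖T^{(1234)}‖² ≤ 2⁴ (d_1² − 1)(d_3² − 1)/(d_1² d_3²). -/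
open Matrix BigOperators

/-- The four-fold Kronecker (tensor) product of square matrices, given entrywise. -/
def kron4 {d1 d2 d3 d4 : ℕ} (M1 : Matrix (Fin d1) (Fin d1) ℂ) (M2 : Matrix (Fin d2) (Fin d2) ℂ)
    (M3 : Matrix (Fin d3) (Fin d3) ℂ) (M4 : Matrix (Fin d4) (Fin d4) ℂ) :
    Matrix (Fin d1 × Fin d2 × Fin d3 × Fin d4) (Fin d1 × Fin d2 × Fin d3 × Fin d4) ℂ :=
  fun a b => M1 a.1 b.1 * M2 a.2.1 b.2.1 * M3 a.2.2.1 b.2.2.1 * M4 a.2.2.2 b.2.2.2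

/-- Completeness relation for a traceless orthogonal family of `n ^ 2 - 1` matrices. -/
theorem sum_mul_entries_of_orthogonal {n : ℕ} (hn : 1 ≤ n)
    (lam : Fin (n ^ 2 - 1) → Matrix (Fin n) (Fin n) ℂ)
    (htr : ∀ i, (lam i).trace = 0)
    (horth : ∀ i j, (lam i * lam j).trace = if i = j then 2 else 0) (a b c e : Fin n) :
    ∑ i, lam i a b * lam i c e =
      (if a = e ∧ b = c then 2 else 0) - (if a = b ∧ c = e then 2 / (n : ℂ) else 0) := by
  have hn0 : (n : ℂ) ≠ 0 := by
    have : n ≠ 0 := by omega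
    exact_mod_cast this
  let V : Matrix (Option (Fin (n ^ 2 - 1))) (Fin n × Fin n) ℂ := fun o x =>
    o.elim ((1 : Matrix (Fin n) (Fin n) ℂ) x.1 x.2) (fun i => lam i x.1 x.2)
  let W : Matrix (Fin n × Fin n) (Option (Fin (n ^ 2 - 1))) ℂ := fun x o =>
    o.elim ((1 : Matrix (Fin n) (Fin n) ℂ) x.2 x.1 / n) (fun i => lam i x.2 x.1 / 2)
  have hVW : V * W = 1 := by
    ext o o'
    rw [Matrix.mul_apply, Fintype.sum_prod_type]
    rcases o with _ | i <;> rcases o' with _ | j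
    · simp [V, W, Matrix.one_apply, hn0]
    · have h := htr j
      simp only [Matrix.trace, Matrix.diag_apply] at h
      simp [V, W, Matrix.one_apply, ← Finset.sum_div, h]
    · have h := htr i
      simp only [Matrix.trace, Matrix.diag_apply] at h
      simp [V, W, Matrix.one_apply, div_eq_mul_inv, ← Finset.sum_mul, h]
    · have h := horth i j
      simp only [Matrix.trace, Matrix.diag_apply, Matrix.mul_apply] at h
      simp only [V, W, Option.elim, ← mul_div_assoc, ← Finset.sum_div, h, Matrix.one_apply,
        Option.some.injEq]
      split_ifs <;> simp
  have hcard : Fintype.card (Option (Fin (n ^ 2 - 1))) = Fintype.card (Fin n × Fin n) := by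
    have : 1 ≤ n ^ 2 := Nat.one_le_pow _ _ hn
    simp only [Fintype.card_option, Fintype.card_fin, Fintype.card_prod]
    rw [← sq]
    omega
  have hWV := (Matrix.mul_eq_one_comm_of_card_eq _ _ _ hcard).1 hVW
  have h := congrFun (congrFun hWV (b, a)) (c, e)
  rw [Matrix.mul_apply, Fintype.sum_option] at h
  simp only [V, W, Option.elim, Matrix.one_apply, Prod.mk.injEq, div_mul_eq_mul_div,
    ← Finset.sum_div] at h
  have h2 : ∑ i, lam i a b * lam i c e = 2 * ((if b = c ∧ a = e then (1 : ℂ) else 0) -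
      (if a = b then (1 : ℂ) else 0) * (if c = e then (1 : ℂ) else 0) / n) := by
    rw [← h]
    ring
  rw [h2]
  simp only [ite_and]
  split_ifs <;> ring

/-- Parseval identity for the coefficients of a matrix against a Hermitian traceless orthogonal
family of maximal size. -/
theorem sum_norm_sq_trace_mul {n : ℕ} (hn : 1 ≤ n)
    (lam : Fin (n ^ 2 - 1) → Matrix (Fin n) (Fin n) ℂ)
    (hherm : ∀ i, (lam i).IsHermitian) (htr : ∀ i, (lam i).trace = 0)
    (horth : ∀ i j, (lam i * lam j).trace = if i = j then 2 else 0)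
    (M : Matrix (Fin n) (Fin n) ℂ) :
    ∑ i, ‖∑ a, ∑ b, M a b * lam i b a‖ ^ 2 =
      2 * ∑ a, ∑ b, ‖M a b‖ ^ 2 - 2 / n * ‖∑ a, M a a‖ ^ 2 := by
  have key : ∀ z : ℂ, ((‖z‖ ^ 2 : ℝ) : ℂ) = z * star z := fun z => by
    simpa using (RCLike.mul_conj z).symm
  have hstar : ∀ i a b, star (lam i b a) = lam i a b := fun i a b => (hherm i).apply a b
  apply Complex.ofReal_injective
  push_cast only [Complex.ofReal_sum, Complex.ofReal_sub, Complex.ofReal_mul, key]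
  have hexp : ∀ i, (∑ a, ∑ b, M a b * lam i b a) * star (∑ a, ∑ b, M a b * lam i b a) =
      ∑ a, ∑ b, ∑ c, ∑ e, M a b * star (M c e) * (lam i b a * lam i c e) := by
    intro i
    simp only [star_sum, star_mul', hstar, Finset.sum_mul]
    simp only [Finset.mul_sum]
    refine Finset.sum_congr rfl fun a _ => Finset.sum_congr rfl fun b _ =>
      Finset.sum_congr rfl fun c _ => Finset.sum_congr rfl fun e _ => by ring
  simp only [hexp]
  rw [Finset.sum_comm]
  have hcomm : ∀ a, ∑ i, ∑ b, ∑ c, ∑ e, M a b * star (M c e) * (lam i b a * lam i c e) =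
      ∑ b, ∑ c, ∑ e, M a b * star (M c e) * ∑ i, lam i b a * lam i c e := by
    intro a
    rw [Finset.sum_comm]
    refine Finset.sum_congr rfl fun b _ => ?_
    rw [Finset.sum_comm]
    refine Finset.sum_congr rfl fun c _ => ?_
    rw [Finset.sum_comm]
    simp only [Finset.mul_sum]
  simp only [hcomm, sum_mul_entries_of_orthogonal hn lam htr horth, mul_sub,
    Finset.sum_sub_distrib, ite_and, mul_ite, mul_zero, Finset.sum_ite_eq, Finset.mem_univ,
    if_true, star_sum, Finset.sum_ite_irrel, Finset.sum_const_zero]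
  simp only [Finset.sum_mul, Finset.mul_sum, Finset.sum_ite_eq', Finset.mem_univ,
    if_true]
  congr 1
  · refine Finset.sum_congr rfl fun a _ => Finset.sum_congr rfl fun b _ => ?_
    push_cast
    ring
  · rw [Finset.sum_comm]
    refine Finset.sum_congr rfl fun a _ => Finset.sum_congr rfl fun b _ => ?_
    push_cast
    ring

/-- The squared norm of the bipartite correlation tensor in terms of purities. -/
theorem sum_norm_sq_correlation {m n : ℕ} (hm : 1 ≤ m) (hn : 1 ≤ n)
    (lam : Fin (m ^ 2 - 1) → Matrix (Fin m) (Fin m) ℂ)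
    (mu : Fin (n ^ 2 - 1) → Matrix (Fin n) (Fin n) ℂ)
    (hherm : ∀ i, (lam i).IsHermitian) (hherm' : ∀ i, (mu i).IsHermitian)
    (htr : ∀ i, (lam i).trace = 0) (htr' : ∀ i, (mu i).trace = 0)
    (horth : ∀ i j, (lam i * lam j).trace = if i = j then 2 else 0)
    (horth' : ∀ i j, (mu i * mu j).trace = if i = j then 2 else 0)
    (R : Fin m → Fin m → Matrix (Fin n) (Fin n) ℂ) :
    ∑ i, ∑ j, ‖∑ a, ∑ a', (∑ b, ∑ b', R a a' b b' * mu j b' b) * lam i a' a‖ ^ 2 =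
      4 * (∑ a, ∑ a', ∑ b, ∑ b', ‖R a a' b b'‖ ^ 2)
        - 4 / n * (∑ a, ∑ a', ‖∑ b, R a a' b b‖ ^ 2)
        - 4 / m * (∑ b, ∑ b', ‖∑ a, R a a b b'‖ ^ 2)
        + 4 / (m * n) * ‖∑ b, ∑ a, R a a b b‖ ^ 2 := by
  rw [Finset.sum_comm]
  have h1 := fun j => sum_norm_sq_trace_mul hm lam hherm htr horth
    (fun a a' => ∑ b, ∑ b', R a a' b b' * mu j b' b)
  simp only [h1, Finset.sum_sub_distrib, ← Finset.mul_sum]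
  have h2 : ∑ j, ∑ a, ∑ a', ‖∑ b, ∑ b', R a a' b b' * mu j b' b‖ ^ 2 =
      ∑ a, ∑ a', (2 * ∑ b, ∑ b', ‖R a a' b b'‖ ^ 2 - 2 / n * ‖∑ b, R a a' b b‖ ^ 2) := by
    rw [Finset.sum_comm]
    refine Finset.sum_congr rfl fun a _ => ?_
    rw [Finset.sum_comm]
    exact Finset.sum_congr rfl fun a' _ =>
      sum_norm_sq_trace_mul hn mu hherm' htr' horth' (R a a')
  have h3 : ∀ j, ∑ a, ∑ b, ∑ b', R a a b b' * mu j b' b =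
      ∑ b, ∑ b', (∑ a, R a a b b') * mu j b' b := by
    intro j
    rw [Finset.sum_comm]
    refine Finset.sum_congr rfl fun b _ => ?_
    rw [Finset.sum_comm]
    simp only [Finset.sum_mul]
  have h4 := sum_norm_sq_trace_mul hn mu hherm' htr' horth' (fun b b' => ∑ a, R a a b b')
  simp only [h2, h3, h4, Finset.sum_sub_distrib, ← Finset.mul_sum]
  have hm0 : (m : ℝ) ≠ 0 := by
    have : m ≠ 0 := by omega
    exact_mod_cast this
  have hn0 : (n : ℝ) ≠ 0 := by
    have : n ≠ 0 := by omega
    exact_mod_cast this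
  field_simp
  ring

/-- The two reduced states of a bipartite pure state have the same purity. -/
theorem sum_norm_sq_reduced_eq_s14 {m n : ℕ} (φ : Fin m × Fin n → ℂ) :
    ∑ b, ∑ b', ‖∑ a, φ (a, b) * star (φ (a, b'))‖ ^ 2 =
      ∑ a, ∑ a', ‖∑ b, φ (a, b) * star (φ (a', b))‖ ^ 2 := by
  have key : ∀ z : ℂ, ((‖z‖ ^ 2 : ℝ) : ℂ) = z * star z := fun z => by
    simpa using (RCLike.mul_conj z).symm
  apply Complex.ofReal_injective
  simp only [Complex.ofReal_sum, key, star_sum, star_mul', star_star, Finset.sum_mul,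
    Finset.mul_sum]
  have hsplit : ∀ f : Fin n → Fin n → Fin m → Fin m → ℂ,
      ∑ x, ∑ y, ∑ z, ∑ w, f x y z w = ∑ z, ∑ w, ∑ x, ∑ y, f x y z w := by
    intro f
    have h := Finset.sum_comm (s := (Finset.univ : Finset (Fin n × Fin n)))
      (t := (Finset.univ : Finset (Fin m × Fin m))) (f := fun x z => f x.1 x.2 z.1 z.2)
    simpa only [Fintype.sum_prod_type] using h
  rw [hsplit]
  refine Finset.sum_congr rfl fun a _ => Finset.sum_congr rfl fun a' _ =>
    Finset.sum_congr rfl fun b _ => Finset.sum_congr rfl fun b' _ => by ring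

/-- The correlation tensor of a bipartite pure state obeys
`‖T‖² ≤ 4 (m² - 1) / m²`, where `m` is the smaller dimension. -/
theorem pure_correlation_bound_s14 {m n : ℕ} (hm : 1 ≤ m) (hmn : m ≤ n)
    (lam : Fin (m ^ 2 - 1) → Matrix (Fin m) (Fin m) ℂ)
    (mu : Fin (n ^ 2 - 1) → Matrix (Fin n) (Fin n) ℂ)
    (hherm : ∀ i, (lam i).IsHermitian) (hherm' : ∀ i, (mu i).IsHermitian)
    (htr : ∀ i, (lam i).trace = 0) (htr' : ∀ i, (mu i).trace = 0)
    (horth : ∀ i j, (lam i * lam j).trace = if i = j then 2 else 0)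
    (horth' : ∀ i j, (mu i * mu j).trace = if i = j then 2 else 0)
    (φ : Fin m × Fin n → ℂ) (hφ : ∑ y, ‖φ y‖ ^ 2 = 1) :
    ∑ i, ∑ j, ‖∑ x : Fin m × Fin n, ∑ y : Fin m × Fin n,
        φ x * star (φ y) * (lam i y.1 x.1 * mu j y.2 x.2)‖ ^ 2 ≤
      4 * ((m : ℝ) ^ 2 - 1) / (m : ℝ) ^ 2 := by
  have key : ∀ z : ℂ, ((‖z‖ ^ 2 : ℝ) : ℂ) = z * star z := fun z => by
    simpa using (RCLike.mul_conj z).symm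
  have hn : 1 ≤ n := hm.trans hmn
  have hm0 : (0 : ℝ) < m := by exact_mod_cast hm
  have hn0 : (0 : ℝ) < n := by exact_mod_cast hn
  have hS := sum_norm_sq_correlation hm hn lam mu hherm hherm' htr htr' horth horth'
    (fun a a' b b' => φ (a, b) * star (φ (a', b')))
  have hL : ∀ i j, ∑ x : Fin m × Fin n, ∑ y : Fin m × Fin n,
        φ x * star (φ y) * (lam i y.1 x.1 * mu j y.2 x.2) =
      ∑ a, ∑ a', (∑ b, ∑ b', φ (a, b) * star (φ (a', b')) * mu j b' b) * lam i a' a := by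
    intro i j
    simp only [Fintype.sum_prod_type, Finset.sum_mul]
    refine Finset.sum_congr rfl fun a _ => ?_
    rw [Finset.sum_comm]
    refine Finset.sum_congr rfl fun a' _ => Finset.sum_congr rfl fun b _ =>
      Finset.sum_congr rfl fun b' _ => by ring
  have hφ' : ∑ a, ∑ b, ‖φ (a, b)‖ ^ 2 = 1 := by
    rw [← hφ, Fintype.sum_prod_type]
  have hpur : ∑ a, ∑ a', ∑ b, ∑ b', ‖φ (a, b) * star (φ (a', b'))‖ ^ 2 = 1 := by
    simp only [norm_mul, norm_star, mul_pow, ← Finset.mul_sum, ← Finset.sum_mul, hφ', mul_one]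
  have htrace : ∑ a, ∑ b, φ (a, b) * star (φ (a, b)) = 1 := by
    simp only [← key, ← Complex.ofReal_sum, hφ', Complex.ofReal_one]
  have hP : 1 ≤ m * ∑ a, ∑ a', ‖∑ b, φ (a, b) * star (φ (a', b))‖ ^ 2 := by
    calc (1 : ℝ) = ‖∑ a, ∑ b, φ (a, b) * star (φ (a, b))‖ ^ 2 := by rw [htrace]; simp
      _ ≤ (∑ a, ‖∑ b, φ (a, b) * star (φ (a, b))‖) ^ 2 := by
        gcongr
        exact norm_sum_le _ _
      _ ≤ m * ∑ a, ‖∑ b, φ (a, b) * star (φ (a, b))‖ ^ 2 := by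
        simpa using sq_sum_le_card_mul_sum_sq (s := Finset.univ)
          (f := fun a => ‖∑ b, φ (a, b) * star (φ (a, b))‖)
      _ ≤ _ := by
        gcongr with a
        exact Finset.single_le_sum (f := fun a' => ‖∑ b, φ (a, b) * star (φ (a', b))‖ ^ 2)
          (fun _ _ => by positivity) (Finset.mem_univ a)
  simp only [hL]
  rw [hS, hpur, sum_norm_sq_reduced_eq_s14, Finset.sum_comm (f := fun b a => φ (a, b) * star (φ (a, b))),
    htrace]
  set P := ∑ a, ∑ a', ‖∑ b, φ (a, b) * star (φ (a', b))‖ ^ 2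
  have hP' : 1 / m ≤ P := by
    rw [div_le_iff₀ hm0]; linarith
  have h1 : 4 / n * (1 / m) ≤ 4 / n * P := by gcongr
  have h2 : 4 / m * (1 / m) ≤ 4 / m * P := by gcongr
  have h3 : 4 * ((m : ℝ) ^ 2 - 1) / (m : ℝ) ^ 2 =
      4 * 1 - 4 / n * (1 / m) - 4 / m * (1 / m) + 4 / (m * n) * ‖(1 : ℂ)‖ ^ 2 := by
    rw [norm_one]
    field_simp
    ring
  rw [h3]
  linarith

/-- Convexity of the squared norm, for finite convex combinations of complex numbers. -/
theorem norm_sq_sum_le_of_convex {N : ℕ} (p : Fin N → ℝ) (hp : ∀ k, 0 < p k)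
    (hsum : ∑ k, p k = 1) (t : Fin N → ℂ) :
    ‖∑ k, (p k : ℂ) * t k‖ ^ 2 ≤ ∑ k, p k * ‖t k‖ ^ 2 := by
  calc ‖∑ k, (p k : ℂ) * t k‖ ^ 2 ≤ (∑ k, p k * ‖t k‖) ^ 2 := by
        gcongr
        refine (norm_sum_le _ _).trans_eq (Finset.sum_congr rfl fun k _ => ?_)
        rw [norm_mul, Complex.norm_of_nonneg (hp k).le]
    _ ≤ _ := by
        simpa using (convexOn_pow 2).map_sum_le (t := Finset.univ) (w := p) (p := fun k => ‖t k‖)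
          (fun k _ => (hp k).le) hsum (fun k _ => norm_nonneg _)

/-- Expectation values of product observables factorize over a product vector. -/
theorem trace_vecMulVec_mul_kron4 {d1 d2 d3 d4 : ℕ} (φ : Fin d1 × Fin d2 → ℂ)
    (ψ : Fin d3 × Fin d4 → ℂ)
    (A : Matrix (Fin d1) (Fin d1) ℂ) (B : Matrix (Fin d2) (Fin d2) ℂ)
    (C : Matrix (Fin d3) (Fin d3) ℂ) (D : Matrix (Fin d4) (Fin d4) ℂ) :
    (vecMulVec (fun x : Fin d1 × Fin d2 × Fin d3 × Fin d4 =>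
        φ (x.1, x.2.1) * ψ (x.2.2.1, x.2.2.2))
      (star fun x : Fin d1 × Fin d2 × Fin d3 × Fin d4 => φ (x.1, x.2.1) * ψ (x.2.2.1, x.2.2.2)) * kron4 A B C D).trace =
    (∑ x : Fin d1 × Fin d2, ∑ y : Fin d1 × Fin d2,
        φ x * star (φ y) * (A y.1 x.1 * B y.2 x.2)) *
      ∑ x : Fin d3 × Fin d4, ∑ y : Fin d3 × Fin d4,
        ψ x * star (ψ y) * (C y.1 x.1 * D y.2 x.2) := by
  let e := Equiv.prodAssoc (Fin d1) (Fin d2) (Fin d3 × Fin d4)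
  simp only [Matrix.trace, Matrix.diag_apply, Matrix.mul_apply]
  rw [← e.sum_comp, Fintype.sum_prod_type, Finset.sum_mul_sum]
  refine Finset.sum_congr rfl fun x _ => Finset.sum_congr rfl fun z _ => ?_
  rw [← e.sum_comp, Fintype.sum_prod_type, Finset.sum_mul_sum]
  refine Finset.sum_congr rfl fun y _ => Finset.sum_congr rfl fun w _ => ?_
  simp only [e, Equiv.prodAssoc_apply, vecMulVec_apply, Pi.star_apply, kron4, star_mul']
  ring

/-- For a (2,2)-separable four-partite state (convex combination of |φ₁₂⟩⊗|φ₃₄⟩),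
‖T^{(1234)}‖² ≤ 2⁴(d₁²−1)(d₃²−1)/(d₁²d₃²). -/
theorem sep22_correlation_bound (d1 d2 d3 d4 : ℕ)
    (h1 : 2 ≤ d1) (h12 : d1 ≤ d2) (h23 : d2 ≤ d3) (h34 : d3 ≤ d4)
    (ρ : Matrix (Fin d1 × Fin d2 × Fin d3 × Fin d4) (Fin d1 × Fin d2 × Fin d3 × Fin d4) ℂ)
    (hsep : ∃ (N : ℕ) (p : Fin N → ℝ) (φ12 : Fin N → Fin d1 × Fin d2 → ℂ)
        (φ34 : Fin N → Fin d3 × Fin d4 → ℂ),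
        (∀ k, 0 < p k) ∧ (∑ k, p k = 1) ∧
        (∀ k, ∑ y, ‖φ12 k y‖ ^ 2 = 1) ∧ (∀ k, ∑ y, ‖φ34 k y‖ ^ 2 = 1) ∧
        ρ = ∑ k, (p k : ℂ) •
          vecMulVec (fun x => φ12 k (x.1, x.2.1) * φ34 k (x.2.2.1, x.2.2.2))
            (star fun x => φ12 k (x.1, x.2.1) * φ34 k (x.2.2.1, x.2.2.2)))
    (lam1 : Fin (d1 ^ 2 - 1) → Matrix (Fin d1) (Fin d1) ℂ)
    (lam2 : Fin (d2 ^ 2 - 1) → Matrix (Fin d2) (Fin d2) ℂ)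
    (lam3 : Fin (d3 ^ 2 - 1) → Matrix (Fin d3) (Fin d3) ℂ)
    (lam4 : Fin (d4 ^ 2 - 1) → Matrix (Fin d4) (Fin d4) ℂ)
    (hherm1 : ∀ i, (lam1 i).IsHermitian) (hherm2 : ∀ i, (lam2 i).IsHermitian)
    (hherm3 : ∀ i, (lam3 i).IsHermitian) (hherm4 : ∀ i, (lam4 i).IsHermitian)
    (htr01 : ∀ i, (lam1 i).trace = 0) (htr02 : ∀ i, (lam2 i).trace = 0)
    (htr03 : ∀ i, (lam3 i).trace = 0) (htr04 : ∀ i, (lam4 i).trace = 0)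
    (horth1 : ∀ i j, (lam1 i * lam1 j).trace = if i = j then 2 else 0)
    (horth2 : ∀ i j, (lam2 i * lam2 j).trace = if i = j then 2 else 0)
    (horth3 : ∀ i j, (lam3 i * lam3 j).trace = if i = j then 2 else 0)
    (horth4 : ∀ i j, (lam4 i * lam4 j).trace = if i = j then 2 else 0) :
    ∑ i : Fin (d1 ^ 2 - 1) × Fin (d2 ^ 2 - 1) × Fin (d3 ^ 2 - 1) × Fin (d4 ^ 2 - 1),
        ‖(ρ * kron4 (lam1 i.1) (lam2 i.2.1) (lam3 i.2.2.1) (lam4 i.2.2.2)).trace‖ ^ 2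
      ≤ 2 ^ 4 * ((d1 : ℝ) ^ 2 - 1) * ((d3 : ℝ) ^ 2 - 1)
          / ((d1 : ℝ) ^ 2 * (d3 : ℝ) ^ 2) := by
  obtain ⟨N, p, φ, ψ, hp, hsum, hφ, hψ, rfl⟩ := hsep
  set F : Fin N → Fin (d1 ^ 2 - 1) → Fin (d2 ^ 2 - 1) → ℂ := fun k i j =>
    ∑ x : Fin d1 × Fin d2, ∑ y : Fin d1 × Fin d2,
      φ k x * star (φ k y) * (lam1 i y.1 x.1 * lam2 j y.2 x.2) with hF
  set G : Fin N → Fin (d3 ^ 2 - 1) → Fin (d4 ^ 2 - 1) → ℂ := fun k i j =>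
    ∑ x : Fin d3 × Fin d4, ∑ y : Fin d3 × Fin d4,
      ψ k x * star (ψ k y) * (lam3 i y.1 x.1 * lam4 j y.2 x.2) with hG
  have hFb : ∀ k, ∑ i, ∑ j, ‖F k i j‖ ^ 2 ≤ 4 * ((d1 : ℝ) ^ 2 - 1) / (d1 : ℝ) ^ 2 := fun k =>
    pure_correlation_bound_s14 (by omega) h12 lam1 lam2 hherm1 hherm2 htr01 htr02 horth1 horth2
      (φ k) (hφ k)
  have hGb : ∀ k, ∑ i, ∑ j, ‖G k i j‖ ^ 2 ≤ 4 * ((d3 : ℝ) ^ 2 - 1) / (d3 : ℝ) ^ 2 := fun k =>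
    pure_correlation_bound_s14 (by omega) h34 lam3 lam4 hherm3 hherm4 htr03 htr04 horth3 horth4
      (ψ k) (hψ k)
  simp only [Matrix.sum_mul, Matrix.trace_sum, Matrix.smul_mul, Matrix.trace_smul,
    trace_vecMulVec_mul_kron4, smul_eq_mul]
  have hprod : ∀ k, ∑ i : Fin (d1 ^ 2 - 1) × Fin (d2 ^ 2 - 1) × Fin (d3 ^ 2 - 1) ×
        Fin (d4 ^ 2 - 1), ‖F k i.1 i.2.1 * G k i.2.2.1 i.2.2.2‖ ^ 2 =
      (∑ i, ∑ j, ‖F k i j‖ ^ 2) * ∑ i, ∑ j, ‖G k i j‖ ^ 2 := by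
    intro k
    simp only [Fintype.sum_prod_type, norm_mul, mul_pow, ← Finset.mul_sum, ← Finset.sum_mul]
  have hnonneg : (0 : ℝ) ≤ 4 * ((d1 : ℝ) ^ 2 - 1) / (d1 : ℝ) ^ 2 :=
    le_trans (by positivity) (pure_correlation_bound_s14 (by omega) h12 lam1 lam2 hherm1 hherm2
      htr01 htr02 horth1 horth2 (Pi.single (⟨0, by omega⟩, ⟨0, by omega⟩) 1)
      (by simp [Pi.single_apply, apply_ite]))
  calc _ ≤ ∑ i : Fin (d1 ^ 2 - 1) × Fin (d2 ^ 2 - 1) × Fin (d3 ^ 2 - 1) × Fin (d4 ^ 2 - 1),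
          ∑ k, p k * ‖F k i.1 i.2.1 * G k i.2.2.1 i.2.2.2‖ ^ 2 :=
        Finset.sum_le_sum fun i _ => norm_sq_sum_le_of_convex p hp hsum _
    _ = ∑ k, p k * ((∑ i, ∑ j, ‖F k i j‖ ^ 2) * ∑ i, ∑ j, ‖G k i j‖ ^ 2) := by
        rw [Finset.sum_comm]
        simp only [← Finset.mul_sum, hprod]
    _ ≤ ∑ k, p k * (4 * ((d1 : ℝ) ^ 2 - 1) / (d1 : ℝ) ^ 2 *
          (4 * ((d3 : ℝ) ^ 2 - 1) / (d3 : ℝ) ^ 2)) := by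
        refine Finset.sum_le_sum fun k _ => mul_le_mul_of_nonneg_left ?_ (hp k).le
        exact mul_le_mul (hFb k) (hGb k) (by positivity) hnonneg
    _ = 2 ^ 4 * ((d1 : ℝ) ^ 2 - 1) * ((d3 : ℝ) ^ 2 - 1) / ((d1 : ℝ) ^ 2 * (d3 : ℝ) ^ 2) := by
        rw [← Finset.sum_mul, hsum]
        ring
end
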